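/- Let C ⊆ F_{p^w}^n be an [n,k] linear code whose dual C^⊥ has minimum distance d^⊥, and let τ = (τ⁽¹⁾,…,τ⁽ⁿ⁾) be functions τ⁽ʲ⁾ : F_{p^w} → F_2^μ with 2^μ < p. Let c_μ = 2^μ·sin(π/2^μ)/(p·sin(π/p)). Then SD(τ(C), τ(U_n)) ≤ (1/2)·p^{w(n−k)}·c_μ^{d^⊥}, where τ(C) denotes the distribution of coordinatewise leakage applied to a uniform codeword and U_n is uniform on F_{p^w}^n. -/

import Mathlib

open Finset Classical

/-- ω_p = e^{2πi/p}. -/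
noncomputable def omg (p : ℕ) : ℂ := Complex.exp (2 * Real.pi * Complex.I / p)

/-- ω_p^{Tr(x)}, where Tr is the field trace from `K` to `ZMod p`. -/
noncomputable def chr (p : ℕ) [Fact p.Prime] (K : Type*) [Field K] [Algebra (ZMod p) K]
    (x : K) : ℂ := omg p ^ (Algebra.trace (ZMod p) K x).val

open Classical in
/-- Probability that coordinatewise leakage `τ` of a uniform element of `SF ⊆ K^n`
equals `ℓ`. -/
noncomputable def leakProb {K : Type*} [Fintype K] {n μ : ℕ}
    (τ : Fin n → K → (Fin μ → ZMod 2)) (SF : Finset (Fin n → K))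
    (ℓ : Fin n → (Fin μ → ZMod 2)) : ℝ :=
  ((SF.filter fun x => ∀ j, τ j (x j) = ℓ j).card : ℝ) / SF.card

theorem bath (β : ℝ) (h0 : 0 ≤ β) (h1 : β ≤ Real.pi) :
    ∫ s in (-Real.pi)..Real.pi, max (Real.cos s - Real.cos β) 0
      = 2 * Real.sin β - 2 * β * Real.cos β := by
  have hc : Continuous fun s : ℝ => max (Real.cos s - Real.cos β) 0 := by fun_prop
  have hi : ∀ a b, IntervalIntegrable (fun s : ℝ => max (Real.cos s - Real.cos β) 0)
      MeasureTheory.volume a b := fun a b => hc.intervalIntegrable a b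
  rw [← intervalIntegral.integral_add_adjacent_intervals (hi (-Real.pi) (-β)) (hi (-β) Real.pi),
    ← intervalIntegral.integral_add_adjacent_intervals (hi (-β) β) (hi β Real.pi)]
  have e1 : ∫ s in (-Real.pi)..(-β), max (Real.cos s - Real.cos β) 0
      = ∫ s in (-Real.pi)..(-β), (0 : ℝ) := by
    apply intervalIntegral.integral_congr
    intro s hs
    rw [Set.uIcc_of_le (by linarith)] at hs
    have : Real.cos (-s) ≤ Real.cos β :=
      Real.cos_le_cos_of_nonneg_of_le_pi h0 (by linarith [hs.1]) (by linarith [hs.2])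
    rw [Real.cos_neg] at this
    exact max_eq_right (by linarith)
  have e3 : ∫ s in β..Real.pi, max (Real.cos s - Real.cos β) 0
      = ∫ s in β..Real.pi, (0 : ℝ) := by
    apply intervalIntegral.integral_congr
    intro s hs
    rw [Set.uIcc_of_le (by linarith)] at hs
    have : Real.cos s ≤ Real.cos β :=
      Real.cos_le_cos_of_nonneg_of_le_pi h0 (by linarith [hs.2]) (by linarith [hs.1])
    exact max_eq_right (by linarith)
  have e2 : ∫ s in (-β)..β, max (Real.cos s - Real.cos β) 0
      = ∫ s in (-β)..β, (Real.cos s - Real.cos β) := by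
    apply intervalIntegral.integral_congr
    intro s hs
    rw [Set.uIcc_of_le (by linarith)] at hs
    have : Real.cos β ≤ Real.cos |s| :=
      Real.cos_le_cos_of_nonneg_of_le_pi (abs_nonneg s) h1 (abs_le.2 hs)
    rw [Real.cos_abs] at this
    exact max_eq_left (by linarith)
  rw [e1, e2, e3, intervalIntegral.integral_sub (by simp) (by simp)]
  simp
  ring

theorem cos_bound (p : ℕ) (hp : 2 ≤ p) (a : ℕ → ℝ) (ha0 : ∀ r, 0 ≤ a r) (ha1 : ∀ r, a r ≤ 1)
    (φ : ℝ) :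
    ∑ r ∈ range p, a r * Real.cos (2 * Real.pi * r / p - φ)
      ≤ Real.sin (Real.pi * (∑ r ∈ range p, a r) / p) / Real.sin (Real.pi / p) := by
  have hp0 : (0 : ℝ) < p := by positivity
  have hp2 : (2 : ℝ) ≤ p := by exact_mod_cast hp
  have hpi := Real.pi_pos
  have hs : 0 < Real.sin (Real.pi / p) := by
    apply Real.sin_pos_of_pos_of_lt_pi (by positivity)
    rw [div_lt_iff₀ hp0]; nlinarith
  set t := ∑ r ∈ range p, a r with ht
  have ht0 : 0 ≤ t := sum_nonneg fun r _ => ha0 r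
  have htp : t ≤ p := by
    calc t ≤ ∑ r ∈ range p, (1 : ℝ) := sum_le_sum fun r _ => ha1 r
      _ = p := by simp
  set β := Real.pi * t / p with hβ
  have hβ0 : 0 ≤ β := by positivity
  have hβ1 : β ≤ Real.pi := by
    rw [hβ, div_le_iff₀ hp0]; nlinarith
  set x : ℕ → ℝ := fun r => 2 * Real.pi * r / p - φ - Real.pi / p with hx
  have hx0 : ∀ r, x r = (2 * Real.pi * r / p - φ) - Real.pi / p := fun r => rfl
  have hx1 : ∀ r, x (r + 1) = (2 * Real.pi * r / p - φ) + Real.pi / p := by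
    intro r; simp only [hx]; push_cast; ring
  have hle : ∀ r, x r ≤ x (r + 1) := by
    intro r; rw [hx0, hx1]; have : 0 < Real.pi / p := by positivity
    linarith
  have hint : ∀ r, ∫ s in (x r)..(x (r + 1)), (Real.cos s - Real.cos β)
      = 2 * Real.sin (Real.pi / p) * Real.cos (2 * Real.pi * r / p - φ)
        - 2 * Real.pi / p * Real.cos β := by
    intro r
    rw [intervalIntegral.integral_sub (by simp) (by simp), integral_cos, hx1, hx0,
      Real.sin_add (2 * Real.pi * r / p - φ), Real.sin_sub (2 * Real.pi * r / p - φ)]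
    simp
    ring
  have hc : Continuous fun s : ℝ => max (Real.cos s - Real.cos β) 0 := by fun_prop
  have hc' : Continuous fun s : ℝ => (Real.cos s - Real.cos β) := by fun_prop
  have hterm : ∀ r, a r * ∫ s in (x r)..(x (r + 1)), (Real.cos s - Real.cos β)
      ≤ ∫ s in (x r)..(x (r + 1)), max (Real.cos s - Real.cos β) 0 := by
    intro r
    have h1 : ∫ s in (x r)..(x (r + 1)), (Real.cos s - Real.cos β)
        ≤ ∫ s in (x r)..(x (r + 1)), max (Real.cos s - Real.cos β) 0 :=
      intervalIntegral.integral_mono_on (hle r) (hc'.intervalIntegrable _ _)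
        (hc.intervalIntegrable _ _) fun s _ => le_max_left _ _
    have h2 : 0 ≤ ∫ s in (x r)..(x (r + 1)), max (Real.cos s - Real.cos β) 0 :=
      intervalIntegral.integral_nonneg (hle r) fun s _ => le_max_right _ _
    nlinarith [ha0 r, ha1 r]
  have hsum := sum_le_sum fun r (_ : r ∈ range p) => hterm r
  rw [intervalIntegral.sum_integral_adjacent_intervals
    (fun k _ => hc.intervalIntegrable _ _)] at hsum
  have hper : Function.Periodic (fun s : ℝ => max (Real.cos s - Real.cos β) 0)
      (2 * Real.pi) := by intro s; simp
  have hxp : x p = x 0 + 2 * Real.pi := by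
    simp only [hx]; field_simp; push_cast; ring
  rw [hxp, hper.intervalIntegral_add_eq (x 0) (-Real.pi),
    show -Real.pi + 2 * Real.pi = Real.pi by ring, bath β hβ0 hβ1] at hsum
  simp only [hint, mul_sub, sum_sub_distrib] at hsum
  rw [← sum_mul, ← ht] at hsum
  have e : ∑ r ∈ range p, a r * (2 * Real.sin (Real.pi / p) * Real.cos (2 * Real.pi * r / p - φ))
      = 2 * Real.sin (Real.pi / p) *
        ∑ r ∈ range p, a r * Real.cos (2 * Real.pi * r / p - φ) := by
    rw [mul_sum]; exact sum_congr rfl fun r _ => by ring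
  rw [e] at hsum
  have e2 : t * (2 * Real.pi / p * Real.cos β) = 2 * β * Real.cos β := by rw [hβ]; ring
  rw [le_div_iff₀ hs]
  linarith

theorem norm_bound (p : ℕ) (hp : 2 ≤ p) (a : ℕ → ℝ) (ha0 : ∀ r, 0 ≤ a r) (ha1 : ∀ r, a r ≤ 1) :
    ‖∑ r ∈ range p, (a r : ℂ) * Complex.exp (2 * Real.pi * Complex.I * r / p)‖
      ≤ Real.sin (Real.pi * (∑ r ∈ range p, a r) / p) / Real.sin (Real.pi / p) := by
  set z := ∑ r ∈ range p, (a r : ℂ) * Complex.exp (2 * Real.pi * Complex.I * r / p) with hz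
  have h1 : (‖z‖ : ℂ) = z * Complex.exp (-(z.arg * Complex.I)) := by
    nth_rewrite 2 [← Complex.norm_mul_exp_arg_mul_I z]
    rw [mul_assoc, ← Complex.exp_add]; simp
  have h2 : ‖z‖ = (z * Complex.exp (-(z.arg * Complex.I))).re := by
    rw [← h1]; simp
  rw [h2]
  convert cos_bound p hp a ha0 ha1 z.arg using 1
  nth_rewrite 1 [hz]
  rw [sum_mul, Complex.re_sum]
  refine sum_congr rfl fun r _ => ?_
  rw [mul_assoc, ← Complex.exp_add, Complex.re_ofReal_mul]
  congr 1
  have : 2 * (Real.pi : ℂ) * Complex.I * r / p + -(z.arg * Complex.I)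
      = ((2 * Real.pi * r / p - z.arg : ℝ) : ℂ) * Complex.I := by push_cast; ring
  rw [this, Complex.exp_ofReal_mul_I_re]

theorem jensen {ι : Type*} [Fintype ι] [Nonempty ι] (x : ι → ℝ) (h0 : ∀ i, 0 ≤ x i)
    (hs : ∑ i, x i = Real.pi) :
    ∑ i, Real.sin (x i) ≤ Fintype.card ι * Real.sin (Real.pi / Fintype.card ι) := by
  have hc : (0 : ℝ) < Fintype.card ι := by exact_mod_cast Fintype.card_pos
  have h := strictConcaveOn_sin_Icc.concaveOn.le_map_sum (t := univ)
    (w := fun _ : ι => (1 : ℝ) / Fintype.card ι) (p := x) (fun _ _ => by positivity)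
    (by simp [hc.ne']) (fun i _ => ⟨h0 i, by
      rw [← hs]; exact single_le_sum (fun j _ => h0 j) (mem_univ i)⟩)
  simp only [smul_eq_mul, ← mul_sum, hs] at h
  rw [one_div_mul_eq_div, one_div_mul_eq_div, div_le_iff₀ hc] at h
  linarith

theorem c_le_one (m p : ℕ) (hm : 1 ≤ m) (hp : m < p) :
    (m : ℝ) * Real.sin (Real.pi / m) / (p * Real.sin (Real.pi / p)) ≤ 1 := by
  have hm0 : (0 : ℝ) < m := by exact_mod_cast hm
  have hmp : (m : ℝ) < p := by exact_mod_cast hp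
  have hm1 : (1 : ℝ) ≤ m := by exact_mod_cast hm
  have hp0 : (0 : ℝ) < p := by linarith
  have hpi := Real.pi_pos
  have hs : 0 < Real.sin (Real.pi / p) := by
    apply Real.sin_pos_of_pos_of_lt_pi (by positivity)
    rw [div_lt_iff₀ hp0]; nlinarith
  rw [div_le_one (by positivity)]
  have hm2 : Real.pi / m ∈ Set.Icc 0 Real.pi := ⟨by positivity, div_le_self hpi.le hm1⟩
  have hm3 : (0 : ℝ) ∈ Set.Icc 0 Real.pi := ⟨le_rfl, hpi.le⟩
  have h := strictConcaveOn_sin_Icc.concaveOn.2 hm3 hm2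
    (show (0 : ℝ) ≤ 1 - m / p by rw [sub_nonneg, div_le_one hp0]; exact hmp.le)
    (show (0 : ℝ) ≤ m / p by positivity) (by ring)
  simp only [smul_eq_mul, Real.sin_zero, mul_zero, zero_add] at h
  rw [show (m : ℝ) / p * (Real.pi / m) = Real.pi / p by field_simp, div_mul_eq_mul_div,
    div_le_iff₀ hp0] at h
  linarith

/-- The additive character `ω_p^{Tr x}`. -/
noncomputable def chi (p : ℕ) [Fact p.Prime] (K : Type) [Field K] [Algebra (ZMod p) K] :
    AddChar K ℂ :=
  (ZMod.stdAddChar (N := p)).compAddMonoidHom (Algebra.trace (ZMod p) K).toAddMonoidHom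

theorem chi_apply (p : ℕ) [Fact p.Prime] (K : Type) [Field K] [Algebra (ZMod p) K] (x : K) :
    chi p K x = Complex.exp
      (2 * Real.pi * Complex.I * (Algebra.trace (ZMod p) K x).val / p) := by
  rw [← ZMod.toCircle_apply, ← ZMod.stdAddChar_apply]; rfl

theorem chi_ne (p : ℕ) [Fact p.Prime] (K : Type) [Field K] [Fintype K] [Algebra (ZMod p) K] :
    ∃ x : K, chi p K x ≠ 1 := by
  obtain ⟨x, hx⟩ := Algebra.trace_surjective (ZMod p) K 1
  refine ⟨x, fun h => ?_⟩
  have h1 : ZMod.stdAddChar (N := p) (Algebra.trace (ZMod p) K x) = 1 := h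
  rw [hx, ← (ZMod.stdAddChar (N := p)).map_zero_eq_one] at h1
  exact one_ne_zero (ZMod.injective_stdAddChar h1)

theorem fiber_card (p : ℕ) [Fact p.Prime] (K : Type) [Field K] [Fintype K] [Algebra (ZMod p) K]
    (α : K) (hα : α ≠ 0) (y : ZMod p) :
    p * (univ.filter fun x : K => Algebra.trace (ZMod p) K (α * x) = y).card
      = Fintype.card K := by
  let f : K →+ ZMod p := (Algebra.trace (ZMod p) K).toAddMonoidHom.comp (AddMonoidHom.mulLeft α)
  have hf : Function.Surjective f := by
    intro z
    obtain ⟨x, hx⟩ := Algebra.trace_surjective (ZMod p) K z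
    refine ⟨α⁻¹ * x, ?_⟩
    change Algebra.trace (ZMod p) K (α * (α⁻¹ * x)) = z
    rw [mul_inv_cancel_left₀ hα, hx]
  have h := card_eq_sum_card_fiberwise (f := f) (s := univ) (t := univ) (fun _ _ => by simp)
  rw [card_univ, sum_congr rfl fun z _ =>
    AddMonoidHom.card_fiber_eq_of_mem_range f (hf z) (hf y)] at h
  rw [h]
  simp [ZMod.card]
  exact Or.inl rfl

theorem char_bound (p : ℕ) [hp : Fact p.Prime] (K : Type) [Field K] [Fintype K]
    [Algebra (ZMod p) K] (α : K) (hα : α ≠ 0) (S : Finset K) :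
    ‖∑ x ∈ S, chi p K (α * x)‖ ≤ (Fintype.card K : ℝ) / p *
      (Real.sin (Real.pi * S.card / Fintype.card K) / Real.sin (Real.pi / p)) := by
  have hp0 : (0 : ℝ) < p := by exact_mod_cast hp.out.pos
  have hq0 : (0 : ℝ) < Fintype.card K := by exact_mod_cast Fintype.card_pos
  set q : ℝ := (Fintype.card K : ℝ) with hq
  set g : K → ℕ := fun x => (Algebra.trace (ZMod p) K (α * x)).val with hg
  have hgm : ∀ x ∈ S, g x ∈ range p := fun x _ => mem_range.2 (ZMod.val_lt _)
  set a : ℕ → ℝ := fun r => (S.filter fun x => g x = r).card / (q / p) with ha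
  have ha1 : ∀ r, a r ≤ 1 := by
    intro r
    simp only [ha]
    rw [div_le_one (by positivity), le_div_iff₀ hp0, hq, ← fiber_card p K α hα r, mul_comm]
    push_cast
    gcongr
    intro x hx
    simp only [mem_filter, mem_univ, true_and] at hx ⊢
    rw [← hx.2, hg]; simp
  have h := norm_bound p hp.out.two_le a (fun r => by simp only [ha]; positivity) ha1
  have hsum : ∑ r ∈ range p, a r = S.card / (q / p) := by
    simp only [ha]
    rw [← sum_div, card_eq_sum_card_fiberwise (f := g) (s := S) (t := range p) hgm]
    push_cast; rfl
  have hz : ∑ x ∈ S, chi p K (α * x) = ((q / p : ℝ) : ℂ) *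
      ∑ r ∈ range p, (a r : ℂ) * Complex.exp (2 * Real.pi * Complex.I * r / p) := by
    rw [← sum_fiberwise_of_maps_to hgm, mul_sum]
    refine sum_congr rfl fun r _ => ?_
    rw [sum_congr rfl (g := fun _ => Complex.exp (2 * Real.pi * Complex.I * r / p)), sum_const,
      nsmul_eq_mul, ← mul_assoc]
    · congr 1
      simp only [ha]
      rw [← Complex.ofReal_mul, mul_div_cancel₀ _ (by positivity)]
      simp
    · intro x hx
      rw [chi_apply, ← (mem_filter.1 hx).2]
  rw [hz, norm_mul, Complex.norm_real, Real.norm_of_nonneg (by positivity)]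
  gcongr
  rw [hsum] at h
  have e : Real.pi * (S.card : ℝ) / q = Real.pi * (S.card / (q / p)) / p := by field_simp
  rw [e]
  exact h

theorem part_bound (p : ℕ) [hp : Fact p.Prime] (K : Type) [Field K] [Fintype K]
    [Algebra (ZMod p) K] {ι : Type} [Fintype ι] [Nonempty ι] (τ : K → ι) (α : K) :
    ∑ l, ‖∑ x ∈ univ.filter (fun x => τ x = l), chi p K (α * x)‖ ≤ (Fintype.card K : ℝ) *
      (if α = 0 then 1 else
        ((Fintype.card ι : ℝ) * Real.sin (Real.pi / Fintype.card ι) /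
          (p * Real.sin (Real.pi / p)))) := by
  have hp0 : (0 : ℝ) < p := by exact_mod_cast hp.out.pos
  have hp2 : (2 : ℝ) ≤ p := by exact_mod_cast hp.out.two_le
  have hpi := Real.pi_pos
  have hq0 : (0 : ℝ) < Fintype.card K := by exact_mod_cast Fintype.card_pos
  have hs : 0 < Real.sin (Real.pi / p) := by
    apply Real.sin_pos_of_pos_of_lt_pi (by positivity)
    rw [div_lt_iff₀ hp0]; nlinarith
  have hcard : ∑ l, ((univ.filter (fun x => τ x = l)).card : ℝ) = Fintype.card K := by
    rw [← card_univ, card_eq_sum_card_fiberwise (f := τ) (s := univ) (t := univ)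
      (fun _ _ => by simp)]
    push_cast; rfl
  split_ifs with h
  · subst h
    simp [hcard]
  · refine (sum_le_sum fun l _ => char_bound p K α h _).trans ?_
    rw [← mul_sum, ← sum_div]
    have hj := jensen (fun l => Real.pi * ((univ.filter (fun x => τ x = l)).card : ℝ) /
      Fintype.card K) (fun l => by positivity) (by
        rw [← sum_div, ← mul_sum, hcard]; field_simp)
    calc _ ≤ (Fintype.card K : ℝ) / p *
        ((Fintype.card ι * Real.sin (Real.pi / Fintype.card ι)) / Real.sin (Real.pi / p)) := by
          gcongr
      _ = _ := by field_simp

theorem sum_code (p n : ℕ) [hp : Fact p.Prime] (K : Type) [Field K] [Fintype K]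
    [Algebra (ZMod p) K] (C : Submodule K (Fin n → K)) (CF : Finset (Fin n → K))
    (hCF : ∀ x, x ∈ CF ↔ x ∈ C) (y : Fin n → K) :
    ∑ x ∈ CF, chi p K (∑ i, x i * y i)
      = if (∀ c ∈ C, ∑ i, c i * y i = 0) then (CF.card : ℂ) else 0 := by
  split_ifs with h
  · rw [sum_congr rfl (g := fun _ => (1 : ℂ))]
    · simp
    · intro x hx
      rw [h x ((hCF x).1 hx), AddChar.map_zero_eq_one]
  · push Not at h
    obtain ⟨c, hc, hcy⟩ := h
    obtain ⟨u, hu⟩ := chi_ne p K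
    set d : Fin n → K := (u * (∑ i, c i * y i)⁻¹) • c with hd
    have hdC : d ∈ C := C.smul_mem _ hc
    have hdy : ∑ i, d i * y i = u := by
      simp only [hd, Pi.smul_apply, smul_eq_mul, mul_assoc, ← mul_sum]
      rw [inv_mul_cancel₀ hcy, mul_one]
    have hshift : ∑ x ∈ CF, chi p K (∑ i, x i * y i)
        = ∑ x ∈ CF, chi p K (∑ i, (d + x) i * y i) := by
      symm
      apply sum_bij (fun x _ => d + x)
      · intro x hx
        exact (hCF _).2 (C.add_mem hdC ((hCF x).1 hx))
      · intro x _ x' _ hxx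
        exact add_left_cancel hxx
      · intro x hx
        exact ⟨x - d, (hCF _).2 (C.sub_mem ((hCF x).1 hx) hdC), by abel⟩
      · intro x _; rfl
    have hmul : ∑ x ∈ CF, chi p K (∑ i, (d + x) i * y i)
        = chi p K u * ∑ x ∈ CF, chi p K (∑ i, x i * y i) := by
      rw [mul_sum]
      refine sum_congr rfl fun x _ => ?_
      rw [← AddChar.map_add_eq_mul, ← hdy, ← sum_add_distrib]
      simp [add_mul]
    rw [hmul] at hshift
    have : (chi p K u - 1) * ∑ x ∈ CF, chi p K (∑ i, x i * y i) = 0 := by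
      rw [sub_mul, ← hshift]; ring
    exact (mul_eq_zero.1 this).resolve_left (sub_ne_zero.2 hu)

theorem sum_all (p n : ℕ) [hp : Fact p.Prime] (K : Type) [Field K] [Fintype K]
    [Algebra (ZMod p) K] (x : Fin n → K) :
    ∑ y : Fin n → K, chi p K (∑ i, x i * y i)
      = if x = 0 then ((Fintype.card K : ℂ) ^ n) else 0 := by
  have h := sum_code p n K ⊤ univ (by simp) x
  simp only [mul_comm] at h ⊢
  rw [h]
  have : (∀ c ∈ (⊤ : Submodule K (Fin n → K)), ∑ i, x i * c i = 0) ↔ x = 0 := by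
    constructor
    · intro hx
      ext j
      simpa [Pi.single_apply] using hx (Pi.single j 1) trivial
    · rintro rfl; simp
  rw [if_congr this rfl rfl]
  simp

theorem chi_sum_prod (p n : ℕ) [hp : Fact p.Prime] (K : Type) [Field K]
    [Algebra (ZMod p) K] (f : Fin n → K) :
    chi p K (∑ i, f i) = ∏ i, chi p K (f i) := by
  have : ∀ s : Finset (Fin n), chi p K (∑ i ∈ s, f i) = ∏ i ∈ s, chi p K (f i) := by
    intro s
    induction s using Finset.induction_on with
    | empty => simp
    | insert a s ha ih => rw [sum_insert ha, prod_insert ha, AddChar.map_add_eq_mul, ih]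
  exact this univ

theorem dual_card (p n : ℕ) [hp : Fact p.Prime] (K : Type) [Field K] [Fintype K]
    [Algebra (ZMod p) K] (C : Submodule K (Fin n → K)) (CF : Finset (Fin n → K))
    (hCF : ∀ x, x ∈ CF ↔ x ∈ C) :
    (CF.card : ℂ) * ((univ.filter fun y : Fin n → K => ∀ c ∈ C, ∑ i, c i * y i = 0).card : ℂ)
      = (Fintype.card K : ℂ) ^ n := by
  have h1 : ∑ y : Fin n → K, ∑ x ∈ CF, chi p K (∑ i, x i * y i)
      = (CF.card : ℂ) *
        ((univ.filter fun y : Fin n → K => ∀ c ∈ C, ∑ i, c i * y i = 0).card : ℂ) := by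
    simp only [sum_code p n K C CF hCF]
    rw [← sum_filter, sum_const, nsmul_eq_mul, mul_comm]
  rw [← h1, sum_comm]
  simp only [sum_all p n K]
  rw [sum_ite_eq' CF (0 : Fin n → K), if_pos ((hCF 0).2 C.zero_mem)]

theorem leak_poisson (p n μ : ℕ) [hp : Fact p.Prime] (K : Type) [Field K] [Fintype K]
    [Algebra (ZMod p) K] (C : Submodule K (Fin n → K)) (CF : Finset (Fin n → K))
    (hCF : ∀ x, x ∈ CF ↔ x ∈ C) (τ : Fin n → K → (Fin μ → ZMod 2))
    (ℓ : Fin n → (Fin μ → ZMod 2)) :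
    ((leakProb τ CF ℓ : ℝ) : ℂ) * (Fintype.card K : ℂ) ^ n =
      ∑ y ∈ univ.filter (fun y : Fin n → K => ∀ c ∈ C, ∑ i, c i * y i = 0),
        ∏ j, ∑ x ∈ univ.filter (fun x => τ j x = ℓ j), chi p K (-y j * x) := by
  have hcf : (CF.card : ℂ) ≠ 0 := by
    have : CF.card ≠ 0 := card_ne_zero_of_mem ((hCF 0).2 C.zero_mem)
    exact_mod_cast this
  set P : Finset (Fin n → K) := univ.filter fun z => ∀ j, τ j (z j) = ℓ j with hP
  have hprod : ∀ y : Fin n → K,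
      ∏ j, ∑ x ∈ univ.filter (fun x => τ j x = ℓ j), chi p K (-y j * x)
        = ∑ z ∈ P, chi p K (-∑ i, z i * y i) := by
    intro y
    rw [prod_univ_sum]
    refine sum_congr ?_ fun z _ => ?_
    · ext z; simp [hP, Fintype.mem_piFinset]
    · rw [← chi_sum_prod, ← sum_neg_distrib]
      congr 1
      exact sum_congr rfl fun i _ => by ring
  simp only [hprod]
  have key : ∑ y : Fin n → K, ∑ z ∈ P, ∑ x ∈ CF, chi p K (∑ i, (x - z) i * y i)
      = (CF.card : ℂ) * ∑ y ∈ univ.filter (fun y : Fin n → K => ∀ c ∈ C, ∑ i, c i * y i = 0),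
          ∑ z ∈ P, chi p K (-∑ i, z i * y i) := by
    rw [sum_filter, mul_sum]
    refine sum_congr rfl fun y _ => ?_
    have : ∀ z, ∑ x ∈ CF, chi p K (∑ i, (x - z) i * y i)
        = chi p K (-∑ i, z i * y i) *
          if (∀ c ∈ C, ∑ i, c i * y i = 0) then (CF.card : ℂ) else 0 := by
      intro z
      rw [← sum_code p n K C CF hCF y, mul_sum]
      refine sum_congr rfl fun x _ => ?_
      rw [← AddChar.map_add_eq_mul]
      congr 1
      simp [sub_mul, sum_sub_distrib]
      ring
    simp only [this]
    rw [← sum_mul]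
    split_ifs <;> ring
  have key2 : ∑ y : Fin n → K, ∑ z ∈ P, ∑ x ∈ CF, chi p K (∑ i, (x - z) i * y i)
      = ((CF.filter fun x => ∀ j, τ j (x j) = ℓ j).card : ℂ) * (Fintype.card K : ℂ) ^ n := by
    rw [sum_comm]
    have : ∀ z, ∑ y : Fin n → K, ∑ x ∈ CF, chi p K (∑ i, (x - z) i * y i)
        = if z ∈ CF then (Fintype.card K : ℂ) ^ n else 0 := by
      intro z
      rw [sum_comm]
      simp only [sum_all p n K, sub_eq_zero]
      rw [sum_ite_eq' CF z]
    simp only [this]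
    rw [← sum_filter, sum_const, nsmul_eq_mul]
    congr 3
    ext z; simp [hP, and_comm]
  rw [key] at key2
  apply mul_left_cancel₀ hcf
  rw [key2]
  unfold leakProb
  push_cast
  field_simp

theorem c_nonneg (m p : ℕ) (hm : 1 ≤ m) (hp : m < p) :
    0 ≤ (m : ℝ) * Real.sin (Real.pi / m) / (p * Real.sin (Real.pi / p)) := by
  have h : ∀ k : ℕ, 1 ≤ k → 0 ≤ (k : ℝ) * Real.sin (Real.pi / k) := by
    intro k hk
    apply mul_nonneg (by positivity)
    apply Real.sin_nonneg_of_nonneg_of_le_pi (by positivity)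
    exact div_le_self Real.pi_pos.le (by exact_mod_cast hk)
  exact div_nonneg (h m hm) (h p (by omega))

open Classical in
/-- `SD(τ(C), τ(U_n)) ≤ (1/2)·p^{w(n−k)}·c_μ^{d^⊥}`, where `C` is an
`[n,k]` code over `K = F_{p^w}`, `d^⊥` is the minimum distance of its dual and
`c_μ = 2^μ sin(π/2^μ)/(p sin(π/p))`, assuming `2^μ < p`. -/
theorem stmt9 (p w n μ k dperp : ℕ) [Fact p.Prime] (hw : 1 ≤ w) (hμ : 2 ^ μ < p)
    (K : Type) [Field K] [Fintype K] [Algebra (ZMod p) K]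
    (hK : Fintype.card K = p ^ w)
    (C : Submodule K (Fin n → K)) (hk : Module.finrank K C = k) (hkn : k ≤ n)
    (CF : Finset (Fin n → K))
    (hCF : ∀ x, x ∈ CF ↔ x ∈ C)
    (hdperp : ∀ y : Fin n → K, (∀ c ∈ C, ∑ i, c i * y i = 0) → y ≠ 0 →
      dperp ≤ hammingNorm y)
    (τ : Fin n → K → (Fin μ → ZMod 2)) :
    (1 / 2 : ℝ) * ∑ ℓ : Fin n → (Fin μ → ZMod 2),
        |leakProb τ CF ℓ - leakProb τ Finset.univ ℓ|
      ≤ (1 / 2 : ℝ) * (p : ℝ) ^ (w * (n - k)) *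
          ((2 : ℝ) ^ μ * Real.sin (Real.pi / 2 ^ μ) / (p * Real.sin (Real.pi / p)))
            ^ dperp := by
  set D : Finset (Fin n → K) :=
    univ.filter fun y : Fin n → K => ∀ c ∈ C, ∑ i, c i * y i = 0 with hD
  set q : ℝ := (Fintype.card K : ℝ) with hq
  have hq0 : 0 < q := by rw [hq]; exact_mod_cast Fintype.card_pos
  have hm : 1 ≤ 2 ^ μ := Nat.one_le_two_pow
  set c : ℝ := (2 : ℝ) ^ μ * Real.sin (Real.pi / 2 ^ μ) / (p * Real.sin (Real.pi / p)) with hc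
  have hc0 : 0 ≤ c := by
    have := c_nonneg (2 ^ μ) p hm hμ
    push_cast at this; exact this
  have hc1 : c ≤ 1 := by
    have := c_le_one (2 ^ μ) p hm hμ
    push_cast at this; exact this
  let T : (Fin n → K) → (Fin n → (Fin μ → ZMod 2)) → ℂ := fun y ℓ =>
    ∏ j, ∑ x ∈ univ.filter (fun x => τ j x = ℓ j), chi p K (-y j * x)
  have h0D : (0 : Fin n → K) ∈ D := by simp [hD]
  -- the uniform distribution is the zero-frequency term
  have hU : ∀ ℓ, ((leakProb τ univ ℓ : ℝ) : ℂ) * (Fintype.card K : ℂ) ^ n = T 0 ℓ := by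
    intro ℓ
    rw [leak_poisson p n μ K ⊤ univ (by simp) τ ℓ]
    have : univ.filter (fun y : Fin n → K => ∀ c ∈ (⊤ : Submodule K (Fin n → K)),
        ∑ i, c i * y i = 0) = {0} := by
      ext y
      simp only [mem_filter, mem_univ, true_and, mem_singleton]
      constructor
      · intro hy
        ext j
        simpa [Pi.single_apply] using hy (Pi.single j 1) trivial
      · rintro rfl; simp
    rw [this, sum_singleton]
  have hdiff : ∀ ℓ, |leakProb τ CF ℓ - leakProb τ univ ℓ| * q ^ n
      ≤ ∑ y ∈ D.erase 0, ‖T y ℓ‖ := by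
    intro ℓ
    have h : ((leakProb τ CF ℓ - leakProb τ univ ℓ : ℝ) : ℂ) * (Fintype.card K : ℂ) ^ n
        = ∑ y ∈ D.erase 0, T y ℓ := by
      push_cast
      rw [sub_mul, hU, leak_poisson p n μ K C CF hCF τ ℓ, ← sum_erase_add _ _ h0D]
      exact add_sub_cancel_right _ _
    have h2 : |leakProb τ CF ℓ - leakProb τ univ ℓ| * q ^ n = ‖∑ y ∈ D.erase 0, T y ℓ‖ := by
      rw [← h, norm_mul, Complex.norm_real, norm_pow, Complex.norm_natCast, Real.norm_eq_abs]
    rw [h2]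
    exact norm_sum_le _ _
  have hy : ∀ y ∈ D.erase 0, ∑ ℓ, ‖T y ℓ‖ ≤ q ^ n * c ^ dperp := by
    intro y hy
    rw [mem_erase] at hy
    have hyD : ∀ c ∈ C, ∑ i, c i * y i = 0 := (mem_filter.1 hy.2).2
    have e : ∑ ℓ, ‖T y ℓ‖ = ∏ j, ∑ l : Fin μ → ZMod 2,
        ‖∑ x ∈ univ.filter (fun x => τ j x = l), chi p K (-y j * x)‖ := by
      rw [prod_univ_sum]
      simp only [Fintype.piFinset_univ]
      exact sum_congr rfl fun ℓ _ => norm_prod _ _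
    rw [e]
    have hb : ∀ j, ∑ l : Fin μ → ZMod 2,
        ‖∑ x ∈ univ.filter (fun x => τ j x = l), chi p K (-y j * x)‖
          ≤ q * (if y j ≠ 0 then c else 1) := by
      intro j
      have := part_bound p K (τ j) (-y j)
      simp only [Fintype.card_fun, ZMod.card, Fintype.card_fin, Nat.cast_pow, Nat.cast_ofNat,
        neg_eq_zero] at this
      refine le_trans (le_of_eq ?_) (this.trans (le_of_eq ?_))
      · congr!
      by_cases h : y j = 0 <;> simp [h, hc, hq]
    refine (prod_le_prod (fun j _ => sum_nonneg fun _ _ => norm_nonneg _)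
      fun j _ => hb j).trans ?_
    rw [prod_mul_distrib, prod_const, card_univ, Fintype.card_fin, ← prod_filter, prod_const]
    gcongr ?_ * ?_
    refine pow_le_pow_of_le_one hc0 hc1 ?_
    convert hdperp y hyD hy.1 using 1
    unfold hammingNorm
    congr 1
  have hcardC : CF.card = Fintype.card K ^ k := by
    rw [← hk, ← Module.card_eq_pow_finrank (K := K) (V := C)]
    rw [Fintype.card_of_subtype CF hCF]
  have hcardD : (D.card : ℝ) = (p : ℝ) ^ (w * (n - k)) := by
    have h := dual_card p n K C CF hCF
    have h' : CF.card * D.card = Fintype.card K ^ n := by exact_mod_cast h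
    rw [hcardC] at h'
    have h2 : Fintype.card K ^ n = Fintype.card K ^ k * Fintype.card K ^ (n - k) := by
      rw [← pow_add]; congr 1; omega
    rw [h2] at h'
    have h3 := Nat.eq_of_mul_eq_mul_left (pow_pos Fintype.card_pos k) h'
    rw [h3, hK, ← pow_mul]; push_cast; rfl
  have main : (∑ ℓ, |leakProb τ CF ℓ - leakProb τ univ ℓ|) * q ^ n
      ≤ ((p : ℝ) ^ (w * (n - k)) * c ^ dperp) * q ^ n := by
    calc (∑ ℓ, |leakProb τ CF ℓ - leakProb τ univ ℓ|) * q ^ n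
        ≤ ∑ ℓ, ∑ y ∈ D.erase 0, ‖T y ℓ‖ := by
          rw [sum_mul]; exact sum_le_sum fun ℓ _ => hdiff ℓ
      _ = ∑ y ∈ D.erase 0, ∑ ℓ, ‖T y ℓ‖ := sum_comm
      _ ≤ ∑ y ∈ D.erase 0, q ^ n * c ^ dperp := sum_le_sum hy
      _ = ((D.erase 0).card : ℝ) * (q ^ n * c ^ dperp) := by rw [sum_const, nsmul_eq_mul]
      _ ≤ (D.card : ℝ) * (q ^ n * c ^ dperp) := by
          gcongr
          exact erase_subset _ _
      _ = _ := by rw [hcardD]; ring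
  have := le_of_mul_le_mul_right main (pow_pos hq0 n)
  rw [mul_assoc]
  gcongr
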